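/- arXiv:1607.02111 — 2 statements merged into one kernel-verified Lean document; each statement's English description precedes it below -/
import Mathlib

section
/- Cohn-Elkies linear programming bound: Let f : R^n → R be a Schwartz function and r1 > 0 with f̂(0) = 1, f̂(u) ≥ 0 for all u ∈ R^n, and f(x) ≤ 0 whenever ‖x‖ ≥ r1. Then for any full-rank lattice L ⊆ R^n and points x_1,…,x_m ∈ R^n such that the balls of radius r1/2 around the points of ∪_i (x_i + L) are pairwise disjoint, the density m·vol(B_n(r1/2))/vol(R^n/L) is at most f(0)·vol(B_n(r1/2)). -/
open MeasureTheory
open scoped FourierTransform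

/-- The lattice with basis the rows of `B`. -/
def latticeOf {n : ℕ} (B : Matrix (Fin n) (Fin n) ℝ) : Set (EuclideanSpace ℝ (Fin n)) :=
  {v | ∃ c : Fin n → ℤ, v = fun j => ∑ i, (c i : ℝ) * B i j}

section PoissonSummation

variable {ι : Type*}

/-- The integer vector `k` viewed as a real vector. -/
def intVec (k : ι → ℤ) : ι → ℝ := fun i => (k i : ℝ)

/-- The covering map from `ℝ^ι` to the torus. -/
def torusMk (y : ι → ℝ) : UnitAddTorus ι := fun i => (y i : UnitAddCircle)

lemma isQuotientMap_torusMk : Topology.IsQuotientMap (torusMk (ι := ι)) :=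
  (IsOpenQuotientMap.piMap (f := fun (_ : ι) (t : ℝ) => (t : UnitAddCircle))
    fun _ => QuotientAddGroup.isOpenQuotientMap_mk).isQuotientMap

lemma continuous_torusMk : Continuous (torusMk (ι := ι)) :=
  isQuotientMap_torusMk.continuous

lemma torusMk_add_intVec (y : ι → ℝ) (k : ι → ℤ) : torusMk (y + intVec k) = torusMk y := by
  ext i
  simp [torusMk, intVec]

lemma exists_eq_add_intVec_of_torusMk_eq {y z : ι → ℝ} (h : torusMk y = torusMk z) :
    ∃ k : ι → ℤ, z = y + intVec k := by
  have hi (i : ι) : ∃ k : ℤ, z i = y i + k := by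
    have h0 : ((z i - y i : ℝ) : UnitAddCircle) = 0 := by
      rw [AddCircle.coe_sub, sub_eq_zero]
      exact (congrFun h i).symm
    obtain ⟨k, hk⟩ := (AddCircle.coe_eq_zero_iff (1 : ℝ)).mp h0
    exact ⟨k, by rw [zsmul_one] at hk; linarith⟩
  choose k hk using hi
  exact ⟨k, funext hk⟩

variable [Fintype ι]

/-- The standard integer lattice is parametrized by integer vectors. -/
noncomputable def intVecEquiv :
    (ι → ℤ) ≃ Submodule.span ℤ (Set.range (Pi.basisFun ℝ ι)) :=
  ((Pi.basisFun ℝ ι).restrictScalars ℤ).equivFun.toEquiv.symm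

lemma coe_intVecEquiv (k : ι → ℤ) : (intVecEquiv k : ι → ℝ) = intVec k := by
  classical
  ext j
  simp [intVecEquiv, intVec, Module.Basis.equivFun_symm_apply, Finset.sum_apply, Pi.single_apply]

lemma summable_one_add_norm_intVec_inv_pow {N : ℕ} (hN : Fintype.card ι < N) :
    Summable fun k : ι → ℤ => ((1 + ‖intVec k‖) ^ N)⁻¹ := by
  have hrank : Module.finrank ℤ (Submodule.span ℤ (Set.range (Pi.basisFun ℝ ι))) < N := by
    rwa [Module.finrank_eq_card_basis ((Pi.basisFun ℝ ι).restrictScalars ℤ)]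
  have h := (intVecEquiv (ι := ι)).summable_iff.mpr
    (ZLattice.summable_norm_pow_inv _ N hrank)
  refine Summable.of_norm_bounded_eventually h ?_
  rw [Filter.eventually_cofinite]
  refine (Set.finite_singleton (0 : ι → ℤ)).subset fun k hk => ?_
  by_contra hk0
  refine hk ?_
  have hpos : 0 < ‖intVec k‖ := by
    refine norm_pos_iff.mpr fun h0 => hk0 ?_
    ext i
    simpa [intVec] using congrFun h0 i
  rw [Function.comp_apply, Submodule.coe_norm, coe_intVecEquiv, inv_pow,
    Real.norm_of_nonneg (by positivity)]
  gcongr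
  linarith

lemma SchwartzMap.exists_norm_le_one_add_norm_pow_inv {E F : Type*} [NormedAddCommGroup E]
    [NormedSpace ℝ E] [NormedAddCommGroup F] [NormedSpace ℝ F] (φ : SchwartzMap E F) (N : ℕ) :
    ∃ C : ℝ, 0 ≤ C ∧ ∀ y, ‖φ y‖ ≤ C * ((1 + ‖y‖) ^ N)⁻¹ := by
  refine ⟨2 ^ N * ((Finset.Iic (N, 0)).sup fun m => SchwartzMap.seminorm ℝ m.1 m.2) φ,
    by positivity, fun y => ?_⟩
  have h := SchwartzMap.one_add_le_sup_seminorm_apply (𝕜 := ℝ) (m := (N, 0)) le_rfl le_rfl φ y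
  rw [norm_iteratedFDeriv_zero] at h
  rw [← div_eq_mul_inv, le_div_iff₀ (by positivity), mul_comm]
  exact h

variable (φ : SchwartzMap (ι → ℝ) ℂ)

lemma exists_summable_bound_translates (R : ℝ) :
    ∃ u : (ι → ℤ) → ℝ, Summable u ∧ ∀ k y, ‖y‖ ≤ R → ‖φ (y + intVec k)‖ ≤ u k := by
  set N := Fintype.card ι + 1
  obtain ⟨C, hC, hφ⟩ := φ.exists_norm_le_one_add_norm_pow_inv N
  refine ⟨fun k => C * ((1 + R) ^ N * ((1 + ‖intVec k‖) ^ N)⁻¹),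
    ((summable_one_add_norm_intVec_inv_pow (Nat.lt_succ_self _)).mul_left _).mul_left _,
    fun k y hy => (hφ _).trans ?_⟩
  refine mul_le_mul_of_nonneg_left ?_ hC
  have hR : 0 ≤ R := (norm_nonneg y).trans hy
  rw [← div_eq_mul_inv, inv_eq_one_div, div_le_div_iff₀ (by positivity) (by positivity), one_mul,
    ← mul_pow]
  gcongr
  have h1 : ‖intVec k‖ ≤ ‖y + intVec k‖ + ‖y‖ := by
    simpa using norm_sub_le (y + intVec k) y
  nlinarith [norm_nonneg (y + intVec k)]

lemma summable_translates (y : ι → ℝ) : Summable fun k => φ (y + intVec k) := by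
  obtain ⟨u, hu, hle⟩ := exists_summable_bound_translates φ ‖y‖
  exact hu.of_norm_bounded fun k => hle k y le_rfl

lemma summable_intVec : Summable fun k => φ (intVec k) := by
  simpa using summable_translates φ 0

lemma continuous_periodization : Continuous fun y => ∑' k, φ (y + intVec k) := by
  refine continuous_iff_continuousAt.mpr fun y => ?_
  obtain ⟨u, hu, hle⟩ := exists_summable_bound_translates φ (‖y‖ + 1)
  have hs : Metric.ball (0 : ι → ℝ) (‖y‖ + 1) ∈ nhds y :=
    Metric.isOpen_ball.mem_nhds (by simp)
  refine (continuousOn_tsum (fun k => ?_) hu fun k z hz => hle k z ?_).continuousAt hs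
  · exact (φ.continuous.comp (by fun_prop)).continuousOn
  · simpa using (mem_ball_zero_iff.mp hz).le

lemma periodization_factorsThrough :
    Function.FactorsThrough (fun y => ∑' k, φ (y + intVec k)) (torusMk (ι := ι)) := by
  intro y z h
  obtain ⟨l, rfl⟩ := exists_eq_add_intVec_of_torusMk_eq h
  have (k : ι → ℤ) : y + intVec l + intVec k = y + intVec (l + k) := by
    ext i
    simp [intVec, add_assoc]
  simp only [this]
  exact ((Equiv.addLeft l).tsum_eq fun k => φ (y + intVec k)).symm

/-- The periodization of a Schwartz function, as a function on the torus. -/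
noncomputable def torusPeriodization : C(UnitAddTorus ι, ℂ) :=
  Topology.IsQuotientMap.lift (f := ⟨torusMk, continuous_torusMk⟩) isQuotientMap_torusMk
    ⟨_, continuous_periodization φ⟩ (periodization_factorsThrough φ)

lemma torusPeriodization_torusMk (y : ι → ℝ) :
    torusPeriodization φ (torusMk y) = ∑' k, φ (y + intVec k) :=
  DFunLike.congr_fun (Topology.IsQuotientMap.lift_comp (f := ⟨torusMk, continuous_torusMk⟩)
    isQuotientMap_torusMk ⟨_, continuous_periodization φ⟩ (periodization_factorsThrough φ)) y

lemma norm_mFourier_apply (k : ι → ℤ) (t : UnitAddTorus ι) :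
    ‖UnitAddTorus.mFourier k t‖ = 1 := by
  rw [UnitAddTorus.mFourier, ContinuousMap.coe_mk, norm_prod]
  exact Finset.prod_eq_one fun i _ => Circle.norm_coe _

lemma unitCube_ae_eq :
    ({y : ι → ℝ | ∀ i, y i ∈ Set.Ioc ((0 : ι → ℝ) i) ((0 : ι → ℝ) i + 1)} : Set (ι → ℝ))
      =ᵐ[volume] ZSpan.fundamentalDomain (Pi.basisFun ℝ ι) := by
  rw [ZSpan.fundamentalDomain_pi_basisFun]
  have h1 := Measure.univ_pi_Ioc_ae_eq_Icc (μ := fun _ : ι => (volume : Measure ℝ))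
    (f := fun _ => 0) (g := fun _ => 1)
  have h2 := Measure.univ_pi_Ico_ae_eq_Icc (μ := fun _ : ι => (volume : Measure ℝ))
    (f := fun _ => 0) (g := fun _ => 1)
  have h3 : ({y : ι → ℝ | ∀ i, y i ∈ Set.Ioc ((0 : ι → ℝ) i) ((0 : ι → ℝ) i + 1)} : Set (ι → ℝ))
      = Set.univ.pi fun _ => Set.Ioc 0 1 := by
    ext y
    simp
  rw [h3]
  exact h1.trans h2.symm

lemma integrable_mFourier_mul (k : ι → ℤ) :
    Integrable fun y => UnitAddTorus.mFourier k (torusMk y) * φ y := by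
  refine φ.integrable.norm.mono' ?_ (.of_forall fun y => ?_)
  · exact (((map_continuous _).comp continuous_torusMk).mul φ.continuous).aestronglyMeasurable
  · rw [norm_mul, norm_mFourier_apply, one_mul]

lemma mFourierCoeff_torusPeriodization (k : ι → ℤ) :
    UnitAddTorus.mFourierCoeff (torusPeriodization φ) k =
      ∫ y, UnitAddTorus.mFourier (-k) (torusMk y) * φ y := by
  set D := ZSpan.fundamentalDomain (Pi.basisFun ℝ ι)
  set h : (ι → ℝ) → ℂ := fun y => UnitAddTorus.mFourier (-k) (torusMk y) * φ y
  have hint : Integrable h := integrable_mFourier_mul φ (-k)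
  have hDm : MeasurableSet D := ZSpan.fundamentalDomain_measurableSet _
  have hDfin : volume D < ⊤ := (ZSpan.fundamentalDomain_isBounded _).measure_lt_top
  obtain ⟨u, hu, hle⟩ := exists_summable_bound_translates φ 1
  have hD1 : ∀ y ∈ D, ‖y‖ ≤ 1 := by
    intro y hy
    rw [show D = _ from ZSpan.fundamentalDomain_pi_basisFun] at hy
    refine (pi_norm_le_iff_of_nonneg zero_le_one).mpr fun i => ?_
    have := hy i trivial
    rw [Real.norm_of_nonneg this.1]
    exact this.2.le
  have hbound (l : ι → ℤ) (y : ι → ℝ) (hy : y ∈ D) : ‖h (y + intVec l)‖ ≤ u l := by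
    rw [norm_mul, norm_mFourier_apply, one_mul]
    exact hle l y (hD1 y hy)
  have hinteg (l : ι → ℤ) : Integrable (fun y => h (y + intVec l)) (volume.restrict D) :=
    (hint.comp_add_right (intVec l)).integrableOn
  calc
    _ = ∫ y in D, UnitAddTorus.mFourier (-k) (torusMk y) * torusPeriodization φ (torusMk y) := by
      rw [UnitAddTorus.mFourierCoeff_eq_integral _ k 0, setIntegral_congr_set unitCube_ae_eq]
      rfl
    _ = ∫ y in D, ∑' l : ι → ℤ, h (y + intVec l) := by
      refine integral_congr_ae (.of_forall fun y => ?_)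
      simp only [h, torusPeriodization_torusMk, torusMk_add_intVec, tsum_mul_left]
    _ = ∑' l : ι → ℤ, ∫ y in D, h (y + intVec l) := by
      refine (integral_tsum_of_summable_integral_norm hinteg ?_).symm
      refine Summable.of_nonneg_of_le (fun l => by positivity) (fun l => ?_)
        (hu.mul_right (volume.real D))
      have := norm_setIntegral_le_of_norm_le_const (μ := volume) (C := u l)
        (f := fun y => ‖h (y + intVec l)‖) hDfin (fun y hy => by simpa using hbound l y hy)
      exact (Real.le_norm_self _).trans this
    _ = ∑' l : ι → ℤ, ∫ y in D, h (-(intVecEquiv l) +ᵥ y) := by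
      rw [← (Equiv.neg (ι → ℤ)).tsum_eq]
      refine tsum_congr fun l => ?_
      refine integral_congr_ae (.of_forall fun y => congrArg h ?_)
      rw [Submodule.vadd_def, vadd_eq_add, Submodule.coe_neg, coe_intVecEquiv, add_comm]
      congr 1
      ext i
      simp [intVec]
    _ = ∫ y, h y := by
      have : VAddInvariantMeasure (Submodule.span ℤ (Set.range (Pi.basisFun ℝ ι))) (ι → ℝ) volume :=
        ⟨fun c s _ => measure_preimage_add volume (c : ι → ℝ) s⟩
      rw [intVecEquiv.tsum_eq fun g => ∫ y in D, h (-g +ᵥ y)]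
      exact ((ZSpan.isAddFundamentalDomain (Pi.basisFun ℝ ι) volume).integral_eq_tsum' h hint).symm

/-- **Poisson summation** for Schwartz functions on `ℝ^ι`. -/
theorem hasSum_integral_mFourier_mul
    (hsum : Summable fun k : ι → ℤ => ∫ y, UnitAddTorus.mFourier (-k) (torusMk y) * φ y)
    (y : ι → ℝ) :
    HasSum (fun k : ι → ℤ => (∫ z, UnitAddTorus.mFourier (-k) (torusMk z) * φ z) *
      UnitAddTorus.mFourier k (torusMk y)) (∑' l, φ (y + intVec l)) := by
  simp_rw [← mFourierCoeff_torusPeriodization] at hsum ⊢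
  rw [← torusPeriodization_torusMk]
  exact UnitAddTorus.hasSum_mFourier_series_apply_of_summable hsum _

end PoissonSummation

section LatticePoisson

variable {ι : Type*} [Fintype ι]

lemma mFourier_torusMk (k : ι → ℤ) (y : ι → ℝ) :
    UnitAddTorus.mFourier k (torusMk y) = (Real.fourierChar (intVec k ⬝ᵥ y) : ℂ) := by
  simp only [UnitAddTorus.mFourier, torusMk, ContinuousMap.coe_mk, fourier_coe_apply,
    Real.fourierChar_apply, dotProduct, intVec, ← Complex.exp_sum]
  congr 1
  push_cast
  rw [Finset.mul_sum, Finset.sum_mul]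
  refine Finset.sum_congr rfl fun i _ => ?_
  ring

variable [DecidableEq ι]

/-- The linear equivalence from `ℝ^ι` to Euclidean space given by an invertible matrix. -/
noncomputable def matrixEquiv (M : Matrix ι ι ℝ) (hM : M.det ≠ 0) :
    (ι → ℝ) ≃L[ℝ] EuclideanSpace ℝ ι :=
  (Matrix.toLin'OfInv (Matrix.nonsing_inv_mul M hM.isUnit)
    (Matrix.mul_nonsing_inv M hM.isUnit)).toContinuousLinearEquiv.trans
    (EuclideanSpace.equiv ι ℝ).symm

lemma matrixEquiv_apply (M : Matrix ι ι ℝ) (hM : M.det ≠ 0) (y : ι → ℝ) :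
    matrixEquiv M hM y = WithLp.toLp 2 (M.mulVec y) := rfl

lemma integral_mFourier_mul_comp_matrixEquiv (B : Matrix ι ι ℝ) (hB : B.det ≠ 0)
    (hBt : B.transpose.det ≠ 0) (F : EuclideanSpace ℝ ι → ℂ) (k : ι → ℤ) :
    ∫ y, UnitAddTorus.mFourier (-k) (torusMk y) * F (matrixEquiv B.transpose hBt y) =
      (|B.det|⁻¹ : ℝ) * 𝓕 F (WithLp.toLp 2 (B⁻¹.mulVec (intVec k))) := by
  set w : EuclideanSpace ℝ ι := WithLp.toLp 2 (B⁻¹.mulVec (intVec k))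
  set G : (ι → ℝ) → ℂ := fun z =>
    Real.fourierChar (-inner ℝ (WithLp.toLp 2 z : EuclideanSpace ℝ ι) w) • F (WithLp.toLp 2 z)
  have hG (y : ι → ℝ) : UnitAddTorus.mFourier (-k) (torusMk y) * F (matrixEquiv B.transpose hBt y)
      = G (Matrix.toLin' B.transpose y) := by
    have hinner : inner ℝ (WithLp.toLp 2 (B.transpose.mulVec y) : EuclideanSpace ℝ ι) w
        = intVec k ⬝ᵥ y := by
      rw [EuclideanSpace.inner_toLp_toLp, star_trivial, Matrix.mulVec_transpose, dotProduct_comm,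
        ← Matrix.dotProduct_mulVec, Matrix.mulVec_mulVec,
        Matrix.mul_nonsing_inv B hB.isUnit, Matrix.one_mulVec, dotProduct_comm]
    have hneg : intVec (-k) ⬝ᵥ y = -(intVec k ⬝ᵥ y) := by
      simp [intVec, dotProduct]
    simp only [G, Matrix.toLin'_apply, hinner, mFourier_torusMk, hneg, matrixEquiv_apply]
    rfl
  have hemb : MeasurableEmbedding (Matrix.toLin' B.transpose) :=
    (Matrix.toLin'OfInv (Matrix.nonsing_inv_mul _ hBt.isUnit)
      (Matrix.mul_nonsing_inv _ hBt.isUnit)).toContinuousLinearEquiv.toHomeomorph.measurableEmbedding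
  calc
    _ = ∫ y, G (Matrix.toLin' B.transpose y) := by simp_rw [hG]
    _ = ∫ z, G z ∂(Measure.map (Matrix.toLin' B.transpose) volume) := (hemb.integral_map G).symm
    _ = (|B.det|⁻¹ : ℝ) * ∫ z, G z := by
      rw [Real.map_matrix_volume_pi_eq_smul_volume_pi hBt, integral_smul_measure,
        ENNReal.toReal_ofReal (abs_nonneg _), Matrix.det_transpose, abs_inv, Complex.real_smul]
    _ = _ := by
      rw [Real.fourier_eq, ← (PiLp.volume_preserving_toLp ι).integral_comp
        (MeasurableEquiv.toLp 2 (ι → ℝ)).measurableEmbedding]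

/-- **Poisson summation** for a Schwartz function over the lattice spanned by the rows of `B`. -/
theorem hasSum_fourier_mul_fourierChar (B : Matrix ι ι ℝ) (hB : B.det ≠ 0)
    (F : SchwartzMap (EuclideanSpace ℝ ι) ℂ) (y : ι → ℝ) :
    HasSum (fun k : ι → ℤ => (|B.det|⁻¹ : ℝ) *
        𝓕 (F : EuclideanSpace ℝ ι → ℂ) (WithLp.toLp 2 (B⁻¹.mulVec (intVec k))) *
        (Real.fourierChar (intVec k ⬝ᵥ y) : ℂ))
      (∑' l : ι → ℤ, F (WithLp.toLp 2 (B.transpose.mulVec (y + intVec l)))) := by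
  have hBt : B.transpose.det ≠ 0 := by rwa [Matrix.det_transpose]
  have hBi : B⁻¹.det ≠ 0 := by
    rw [Matrix.det_nonsing_inv, Ring.inverse_eq_inv]
    exact inv_ne_zero hB
  set φ := SchwartzMap.compCLMOfContinuousLinearEquiv ℝ (matrixEquiv B.transpose hBt) F
  have hcoeff (k : ι → ℤ) := integral_mFourier_mul_comp_matrixEquiv B hB hBt F k
  have hsum := (summable_intVec
    (SchwartzMap.compCLMOfContinuousLinearEquiv ℝ (matrixEquiv B⁻¹ hBi) (𝓕 F))).mul_left
    ((|B.det|⁻¹ : ℝ) : ℂ)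
  simp only [SchwartzMap.compCLMOfContinuousLinearEquiv_apply, Function.comp_apply,
    SchwartzMap.fourier_coe, matrixEquiv_apply B⁻¹] at hsum
  have h := hasSum_integral_mFourier_mul φ
  simp only [φ, SchwartzMap.compCLMOfContinuousLinearEquiv_apply, Function.comp_apply,
    hcoeff] at h
  simp only [mFourier_torusMk, matrixEquiv_apply B.transpose] at h
  exact h hsum y

lemma summable_comp_mulVec_add_intVec (B : Matrix ι ι ℝ) (hB : B.det ≠ 0)
    (F : SchwartzMap (EuclideanSpace ℝ ι) ℂ) (y : ι → ℝ) :
    Summable fun l : ι → ℤ => F (WithLp.toLp 2 (B.transpose.mulVec (y + intVec l))) :=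
  summable_translates (SchwartzMap.compCLMOfContinuousLinearEquiv ℝ
    (matrixEquiv B.transpose (by rwa [Matrix.det_transpose])) F) y

/-- The average of a real Schwartz function with nonnegative Fourier transform over differences
of a periodic configuration is bounded below by the contribution of the zero frequency. -/
theorem card_sq_div_abs_det_le_sum_tsum {m : ℕ} (f : SchwartzMap (EuclideanSpace ℝ ι) ℝ)
    (hf0 : 𝓕 (fun x => (f x : ℂ)) 0 = 1)
    (hfpos : ∀ u, 0 ≤ (𝓕 (fun x => (f x : ℂ)) u).re ∧ (𝓕 (fun x => (f x : ℂ)) u).im = 0)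
    (B : Matrix ι ι ℝ) (hB : B.det ≠ 0) (y : Fin m → ι → ℝ) :
    (∀ z : ι → ℝ, Summable fun l : ι → ℤ =>
      f (WithLp.toLp 2 (B.transpose.mulVec (z + intVec l)))) ∧
    (m : ℝ) ^ 2 / |B.det| ≤ ∑ i, ∑ j, ∑' l : ι → ℤ,
      f (WithLp.toLp 2 (B.transpose.mulVec (y i - y j + intVec l))) := by
  set F : SchwartzMap (EuclideanSpace ℝ ι) ℂ := SchwartzMap.postcompCLM Complex.ofRealCLM f
  have hF : (F : EuclideanSpace ℝ ι → ℂ) = fun x => (f x : ℂ) := rfl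
  have hs (z : ι → ℝ) : Summable fun l : ι → ℤ =>
      f (WithLp.toLp 2 (B.transpose.mulVec (z + intVec l))) :=
    Complex.summable_ofReal.mp (summable_comp_mulVec_add_intVec B hB F z)
  refine ⟨hs, ?_⟩
  set c : (ι → ℤ) → ℝ := fun k =>
    (𝓕 (fun x => (f x : ℂ)) (WithLp.toLp 2 (B⁻¹.mulVec (intVec k)))).re
  have hc (k : ι → ℤ) :
      𝓕 (F : EuclideanSpace ℝ ι → ℂ) (WithLp.toLp 2 (B⁻¹.mulVec (intVec k))) = (c k : ℂ) := by
    rw [hF]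
    exact Complex.ext rfl (by simpa using (hfpos _).2)
  have hc0 : c 0 = 1 := by
    have : (WithLp.toLp 2 (B⁻¹.mulVec (intVec 0)) : EuclideanSpace ℝ ι) = 0 := by
      have h0 : intVec (0 : ι → ℤ) = 0 := by ext; simp [intVec]
      rw [h0, Matrix.mulVec_zero, WithLp.toLp_zero]
    simp only [c, this, hf0, Complex.one_re]
  have hcpos (k : ι → ℤ) : 0 ≤ c k := (hfpos _).1
  set S : (ι → ℤ) → ℂ := fun k => ∑ i, (Real.fourierChar (intVec k ⬝ᵥ y i) : ℂ)
  have hterm (k : ι → ℤ) : ∑ i, ∑ j, ((|B.det|⁻¹ : ℝ) * (c k : ℂ) *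
      (Real.fourierChar (intVec k ⬝ᵥ (y i - y j)) : ℂ)) =
      ((|B.det|⁻¹ * c k * Complex.normSq (S k) : ℝ) : ℂ) := by
    have h1 : ∑ i, ∑ j, (Real.fourierChar (intVec k ⬝ᵥ (y i - y j)) : ℂ) =
        S k * (starRingEnd ℂ) (S k) := by
      simp only [S, map_sum, Finset.sum_mul_sum]
      refine Finset.sum_congr rfl fun i _ => Finset.sum_congr rfl fun j _ => ?_
      rw [dotProduct_sub, sub_eq_add_neg, AddChar.map_add_eq_mul, AddChar.map_neg_eq_inv,
        Circle.coe_mul, Circle.coe_inv_eq_conj]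
    simp_rw [← Finset.mul_sum]
    rw [h1, Complex.mul_conj]
    push_cast
    ring
  have hsum : HasSum (fun k : ι → ℤ => |B.det|⁻¹ * c k * Complex.normSq (S k))
      (∑ i, ∑ j, ∑' l : ι → ℤ,
        f (WithLp.toLp 2 (B.transpose.mulVec (y i - y j + intVec l)))) := by
    rw [← Complex.hasSum_ofReal]
    simp_rw [← hterm, Complex.ofReal_sum, Complex.ofReal_tsum]
    refine hasSum_sum fun i _ => hasSum_sum fun j _ => ?_
    have := hasSum_fourier_mul_fourierChar B hB F (y i - y j)
    simp only [hc] at this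
    exact this
  have hle := le_hasSum hsum 0 fun k _ => by
    have := hcpos k
    have := Complex.normSq_nonneg (S k)
    positivity
  have hS0 : S 0 = m := by
    simp [S, intVec, dotProduct]
  rw [hc0, hS0, Complex.normSq_natCast] at hle
  calc _ = |B.det|⁻¹ * 1 * ((m : ℝ) * m) := by ring
    _ ≤ _ := hle

end LatticePoisson

lemma SchwartzMap.apply_zero_nonneg_of_fourier_nonneg {V : Type*} [NormedAddCommGroup V]
    [InnerProductSpace ℝ V] [FiniteDimensional ℝ V] [MeasurableSpace V] [BorelSpace V]
    (f : SchwartzMap V ℝ) (hf : ∀ u, 0 ≤ (𝓕 (fun x => (f x : ℂ)) u).re) : 0 ≤ f 0 := by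
  set F : SchwartzMap V ℂ := SchwartzMap.postcompCLM Complex.ofRealCLM f
  have hint : Integrable (𝓕 (F : V → ℂ)) := by
    rw [← SchwartzMap.fourier_coe]
    exact (𝓕 F).integrable
  have h := congrFun (F.continuous.fourierInv_fourier_eq F.integrable hint) 0
  simp only [Real.fourierInv_eq, inner_zero_right, AddChar.map_zero_eq_one, one_smul] at h
  have hre : (F 0).re = f 0 := Complex.ofReal_re _
  rw [← hre, ← h, ← RCLike.re_eq_complex_re, ← integral_re hint]
  exact integral_nonneg hf

/-- The Cohn–Elkies linear programming bound: if `f` is a Schwartz function with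
`f̂(0) = 1`, `f̂ ≥ 0` everywhere, and `f(x) ≤ 0` for `‖x‖ ≥ r₁`, then the density
of any periodic packing of balls of radius `r₁/2` with centers `∪ᵢ (xᵢ + L)` is
at most `f(0) · vol(Bₙ(r₁/2))`. -/
theorem cohn_elkies {n m : ℕ} (f : SchwartzMap (EuclideanSpace ℝ (Fin n)) ℝ)
    (r₁ : ℝ) (hr₁ : 0 < r₁)
    (hf0 : 𝓕 (fun x => (f x : ℂ)) 0 = 1)
    (hfpos : ∀ u, 0 ≤ (𝓕 (fun x => (f x : ℂ)) u).re ∧ (𝓕 (fun x => (f x : ℂ)) u).im = 0)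
    (hfneg : ∀ x : EuclideanSpace ℝ (Fin n), r₁ ≤ ‖x‖ → f x ≤ 0)
    (B : Matrix (Fin n) (Fin n) ℝ) (hB : B.det ≠ 0)
    (x : Fin m → EuclideanSpace ℝ (Fin n))
    (hpack : ∀ i j : Fin m, ∀ v ∈ latticeOf B, ∀ w ∈ latticeOf B,
      (i ≠ j ∨ v ≠ w) → r₁ ≤ ‖(x i + v) - (x j + w)‖) :
    m * (volume (Metric.ball (0 : EuclideanSpace ℝ (Fin n)) (r₁ / 2))).toReal / |B.det|
      ≤ f 0 * (volume (Metric.ball (0 : EuclideanSpace ℝ (Fin n)) (r₁ / 2))).toReal := by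
  have hV : 0 ≤ (volume (Metric.ball (0 : EuclideanSpace ℝ (Fin n)) (r₁ / 2))).toReal :=
    ENNReal.toReal_nonneg
  rw [mul_div_right_comm]
  refine mul_le_mul_of_nonneg_right ?_ hV
  have hBt : B.transpose.det ≠ 0 := by rwa [Matrix.det_transpose]
  set A := matrixEquiv B.transpose hBt
  set y : Fin m → Fin n → ℝ := fun i => A.symm (x i)
  obtain ⟨hsum, hle⟩ := card_sq_div_abs_det_le_sum_tsum f hf0 hfpos B hB y
  have hlat (l : Fin n → ℤ) : A (intVec l) ∈ latticeOf B := by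
    refine ⟨l, ?_⟩
    ext j
    simp only [A, matrixEquiv_apply, Matrix.mulVec, dotProduct, Matrix.transpose_apply, intVec]
    exact Finset.sum_congr rfl fun i _ => mul_comm _ _
  have hzero : (0 : EuclideanSpace ℝ (Fin n)) ∈ latticeOf B := ⟨0, by ext; simp⟩
  have hterm (i j : Fin m) (l : Fin n → ℤ) (hne : i ≠ j ∨ l ≠ 0) :
      f (WithLp.toLp 2 (B.transpose.mulVec (y i - y j + intVec l))) ≤ 0 := by
    refine hfneg _ ?_
    have hx : (WithLp.toLp 2 (B.transpose.mulVec (y i - y j + intVec l)) :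
        EuclideanSpace ℝ (Fin n)) = (x i + A (intVec l)) - (x j + 0) := by
      rw [← matrixEquiv_apply _ hBt]
      change A _ = _
      simp only [map_add, map_sub, y, A.apply_symm_apply]
      abel
    rw [hx]
    refine hpack i j _ (hlat l) 0 hzero (hne.imp_right fun hl h0 => hl ?_)
    have h0' : intVec l = 0 := by simpa using h0
    ext t
    simpa [intVec] using congrFun h0' t
  have hbound (i j : Fin m) :
      ∑' l, f (WithLp.toLp 2 (B.transpose.mulVec (y i - y j + intVec l))) ≤
        if i = j then f 0 else 0 := by
    split_ifs with hij
    · subst hij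
      rw [(hsum _).tsum_eq_add_tsum_ite 0]
      have h0 : intVec (0 : Fin n → ℤ) = 0 := by ext; simp [intVec]
      rw [sub_self, h0, add_zero, Matrix.mulVec_zero, WithLp.toLp_zero]
      refine add_le_of_nonpos_right (tsum_nonpos fun l => ?_)
      split_ifs with hl
      · exact le_rfl
      · simpa using hterm i i l (.inr hl)
    · exact tsum_nonpos fun l => hterm i j l (.inl hij)
  have htotal : (m : ℝ) ^ 2 / |B.det| ≤ m * f 0 := by
    refine hle.trans ((Finset.sum_le_sum fun i _ => Finset.sum_le_sum fun j _ =>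
      hbound i j).trans_eq ?_)
    simp
  rcases Nat.eq_zero_or_pos m with rfl | hm
  · simpa using f.apply_zero_nonneg_of_fourier_nonneg fun u => (hfpos u).1
  · have hm' : (0 : ℝ) < m := by exact_mod_cast hm
    refine le_of_mul_le_mul_left ?_ hm'
    calc (m : ℝ) * (m / |B.det|) = (m : ℝ) ^ 2 / |B.det| := by ring
      _ ≤ m * f 0 := htotal
end

section
/- Equality analysis for the LP bound: Suppose f : R^n → R is a Schwartz function with f(0) = f̂(0) = 1, f̂ ≥ 0 everywhere, f(x) ≤ 0 for ‖x‖ ≥ r1, and L is a unimodular lattice whose nonzero vectors all have length ≥ r1, with f(0)·vol(B_n(r1/2)) equal to the density of L (i.e., vol(R^n/L) = 1). Then f(x) = 0 and f̂(x) = 0 for every nonzero x ∈ L. -/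
open MeasureTheory
open scoped FourierTransform

/-- The dual lattice of a subset of Euclidean space. -/
def dualLattice {n : ℕ} (L : Set (EuclideanSpace ℝ (Fin n))) :
    Set (EuclideanSpace ℝ (Fin n)) :=
  {y | ∀ v ∈ L, ∃ m : ℤ, inner (𝕜 := ℝ) v y = (m : ℝ)}

open scoped SchwartzMap Matrix

section Poisson

variable {ι : Type*} [Fintype ι]

/-- The norms of the integer points of `ℝ^ι` are summable to any power beyond the dimension. -/
theorem summable_one_add_norm_intCast_pow_inv {k : ℕ} (hk : Fintype.card ι < k) :
    Summable fun m : ι → ℤ => ((1 + ‖fun i => (m i : ℝ)‖) ^ k)⁻¹ := by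
  classical
  let b := Pi.basisFun ℝ ι
  let L := Submodule.span ℤ (Set.range b)
  let c : Module.Basis ι ℤ L := b.restrictScalars ℤ
  have hrank : Module.finrank ℤ L < k := by
    rwa [Module.finrank_eq_card_basis c]
  have hval (m : ι → ℤ) : ((c.equivFun.symm m : L) : ι → ℝ) = fun i => (m i : ℝ) := by
    have hc (i : ι) : ((c i : L) : ι → ℝ) = Pi.single i 1 := by
      rw [b.restrictScalars_apply ℤ, Pi.basisFun_apply]
    ext j
    simp [Module.Basis.equivFun_symm_apply, Finset.sum_apply, hc, Pi.single_apply]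
  have hsum := (ZLattice.summable_norm_pow_inv L k hrank).comp_injective
    c.equivFun.symm.injective
  refine Summable.of_norm_bounded_eventually hsum ?_
  filter_upwards [(Set.finite_singleton (0 : ι → ℤ)).compl_mem_cofinite] with m hm
  have hm : c.equivFun.symm m ≠ 0 := (map_ne_zero_iff _ c.equivFun.symm.injective).mpr hm
  have hpos : 0 < ‖c.equivFun.symm m‖ := norm_pos_iff.mpr hm
  have hnorm : ‖c.equivFun.symm m‖ = ‖fun i => (m i : ℝ)‖ := by
    rw [← hval, Submodule.norm_coe]
  rw [Function.comp_apply, inv_pow, norm_inv, norm_pow, hnorm, Real.norm_of_nonneg (by positivity)]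
  rw [hnorm] at hpos
  gcongr
  simp

/-- A Schwartz function decays faster than any power, with translates controlled locally
uniformly. -/
theorem SchwartzMap.exists_norm_add_le {E F : Type*} [NormedAddCommGroup E] [NormedSpace ℝ E]
    [NormedAddCommGroup F] [NormedSpace ℝ F] (g : 𝓢(E, F)) (k : ℕ) :
    ∃ C, 0 ≤ C ∧ ∀ x y, ‖g (x + y)‖ ≤ C * (1 + ‖x‖) ^ k * ((1 + ‖y‖) ^ k)⁻¹ := by
  refine ⟨2 ^ k * (Finset.Iic (k, 0)).sup (fun m => SchwartzMap.seminorm ℝ m.1 m.2) g,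
    by positivity, fun x y => ?_⟩
  have h := SchwartzMap.one_add_le_sup_seminorm_apply (𝕜 := ℝ) (m := (k, 0)) le_rfl le_rfl g (x + y)
  rw [norm_iteratedFDeriv_zero] at h
  have hy : 1 + ‖y‖ ≤ (1 + ‖x‖) * (1 + ‖x + y‖) := by
    have : ‖y‖ ≤ ‖x + y‖ + ‖x‖ := by simpa using norm_sub_le (x + y) x
    nlinarith [norm_nonneg x, norm_nonneg (x + y)]
  rw [← div_eq_mul_inv, le_div_iff₀ (by positivity)]
  calc ‖g (x + y)‖ * (1 + ‖y‖) ^ k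
      ≤ ‖g (x + y)‖ * ((1 + ‖x‖) * (1 + ‖x + y‖)) ^ k := by gcongr
    _ = ((1 + ‖x + y‖) ^ k * ‖g (x + y)‖) * (1 + ‖x‖) ^ k := by rw [mul_pow]; ring
    _ ≤ _ := by gcongr

/-- A Schwartz function is summable over every translate of `ℤ^ι`. -/
theorem SchwartzMap.summable_add_intCast (g : 𝓢(ι → ℝ, ℂ)) (x : ι → ℝ) :
    Summable fun m : ι → ℤ => g (x + fun i => (m i : ℝ)) := by
  obtain ⟨C, -, hC⟩ := g.exists_norm_add_le (Fintype.card ι + 1)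
  exact .of_norm_bounded
    ((summable_one_add_norm_intCast_pow_inv (Nat.lt_succ_self _)).mul_left _) fun m => hC x _

theorem SchwartzMap.continuous_tsum_add_intCast (g : 𝓢(ι → ℝ, ℂ)) :
    Continuous fun x : ι → ℝ => ∑' m : ι → ℤ, g (x + fun i => (m i : ℝ)) := by
  obtain ⟨C, hC0, hC⟩ := g.exists_norm_add_le (Fintype.card ι + 1)
  refine continuous_iff_continuousAt.mpr fun x => ?_
  refine ContinuousOn.continuousAt (s := Metric.ball 0 (‖x‖ + 1)) ?_
    (Metric.isOpen_ball.mem_nhds (by simp))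
  refine continuousOn_tsum (fun m => (g.continuous.comp (by fun_prop)).continuousOn)
    ((summable_one_add_norm_intCast_pow_inv (Nat.lt_succ_self (Fintype.card ι))).mul_left
      (C * (1 + (‖x‖ + 1)) ^ (Fintype.card ι + 1))) fun m y hy => (hC y _).trans ?_
  have hy : ‖y‖ ≤ ‖x‖ + 1 := (mem_ball_zero_iff.mp hy).le
  gcongr

/-- The integral over `ℝ^ι` is the sum of the integrals over the integer translates of the
unit cube. -/
theorem hasSum_setIntegral_add_intCast {E : Type*} [NormedAddCommGroup E] [NormedSpace ℝ E]
    {h : (ι → ℝ) → E} (hh : Integrable h) :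
    HasSum (fun m : ι → ℤ => ∫ x in {x : ι → ℝ | ∀ i, x i ∈ Set.Ioc (0 : ℝ) (0 + 1)},
      h (x + fun i => (m i : ℝ))) (∫ x, h x) := by
  let S (m : ι → ℤ) : Set (ι → ℝ) := {x | ∀ i, x i - m i ∈ Set.Ioc (0 : ℝ) (0 + 1)}
  have hceil (m : ι → ℤ) (x : ι → ℝ) (hx : x ∈ S m) (i : ι) : m i = ⌈x i⌉ - 1 := by
    have := hx i
    simp only [Set.mem_Ioc] at this
    rw [eq_sub_iff_add_eq, eq_comm, Int.ceil_eq_iff]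
    push_cast
    constructor <;> linarith
  have hS : ⋃ m, S m = Set.univ := by
    refine Set.eq_univ_of_forall fun x => Set.mem_iUnion.mpr ⟨fun i => ⌈x i⌉ - 1, fun i => ?_⟩
    simp only [Set.mem_Ioc]
    push_cast
    constructor <;> linarith [Int.ceil_lt_add_one (x i), Int.le_ceil (x i)]
  have hsum := hasSum_integral_iUnion (μ := volume) (f := h) (s := S)
    (fun m => MeasurableSet.univ_pi' (t := fun i => {t : ℝ | t - m i ∈ Set.Ioc (0 : ℝ) (0 + 1)})
      fun i => (measurable_id.sub_const _) measurableSet_Ioc)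
    (fun m m' hne => Set.disjoint_left.mpr fun x hx hx' =>
      hne (funext fun i => (hceil m x hx i).trans (hceil m' x hx' i).symm))
    (by rw [hS]; exact hh.integrableOn)
  rw [hS, setIntegral_univ] at hsum
  convert! hsum using 2 with m
  rw [← (measurePreserving_add_right volume fun i => (m i : ℝ)).setIntegral_preimage_emb
    (measurableEmbedding_addRight _) h]
  congr 2
  ext x
  simp only [S, Set.mem_preimage, Set.mem_ofPred_eq, Pi.add_apply, add_sub_cancel_right]

open UnitAddTorus

/-- Fourier coefficients of a periodization. -/
theorem SchwartzMap.mFourierCoeff_eq_integral_of_forall_eq_tsum (g : 𝓢(ι → ℝ, ℂ))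
    {F : UnitAddTorus ι → ℂ}
    (hF : ∀ x : ι → ℝ, F (fun i => x i) = ∑' m : ι → ℤ, g (x + fun i => (m i : ℝ)))
    (k : ι → ℤ) :
    mFourierCoeff F k = ∫ x : ι → ℝ, mFourier (-k) (fun i => x i) * g x := by
  let e (x : ι → ℝ) : ℂ := mFourier (-k) (fun i => x i)
  have he : Continuous e := (mFourier (-k)).continuous.comp
    (continuous_pi fun i => (AddCircle.continuous_mk' 1).comp (continuous_apply i))
  have hnorm (x : ι → ℝ) : ‖e x‖ ≤ 1 := by
    simpa only [mFourier_norm] using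
      (mFourier (-k)).norm_coe_le_norm (fun i => (x i : UnitAddCircle))
  have hper (x : ι → ℝ) (m : ι → ℤ) : e (x + fun i => (m i : ℝ)) = e x := by
    have h (i : ι) : ((x i + m i : ℝ) : UnitAddCircle) = x i := by simp
    simp only [e, Pi.add_apply, h]
  have hint : Integrable fun x => e x * g x :=
    g.integrable.bdd_mul he.aestronglyMeasurable (.of_forall hnorm)
  have hsum := hasSum_setIntegral_add_intCast hint
  have hsum_norm := hasSum_setIntegral_add_intCast hint.norm
  have hswap := hasSum_integral_of_summable_integral_norm
    (μ := volume.restrict {x : ι → ℝ | ∀ i, x i ∈ Set.Ioc (0 : ℝ) (0 + 1)})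
    (fun m : ι → ℤ => (hint.comp_add_right fun i => (m i : ℝ)).integrableOn) hsum_norm.summable
  rw [hsum.unique hswap, mFourierCoeff_eq_integral F k 0]
  refine integral_congr_ae (.of_forall fun x => ?_)
  simp only [hper, tsum_mul_left, hF, smul_eq_mul, e]

/-- Poisson summation for Schwartz functions on `ℝ^ι`. -/
theorem SchwartzMap.tsum_intCast_eq_tsum_integral (g : 𝓢(ι → ℝ, ℂ))
    (hg : Summable fun k : ι → ℤ => ∫ x : ι → ℝ, mFourier (-k) (fun i => x i) * g x) :
    ∑' m : ι → ℤ, g (fun i => (m i : ℝ)) =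
      ∑' k : ι → ℤ, ∫ x : ι → ℝ, mFourier (-k) (fun i => x i) * g x := by
  have hq : IsOpenQuotientMap (Pi.map fun _ : ι => ((↑) : ℝ → UnitAddCircle)) :=
    .piMap fun _ => QuotientAddGroup.isOpenQuotientMap_mk
  let P : C(ι → ℝ, ℂ) := ⟨_, g.continuous_tsum_add_intCast⟩
  let q : C(ι → ℝ, UnitAddTorus ι) := ⟨_, hq.continuous⟩
  have hP : Function.FactorsThrough P q := by
    intro x y hxy
    have hex (i : ι) : ∃ a : ℤ, x i + a = y i := by
      have h : (x i : UnitAddCircle) = y i := congrFun hxy i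
      obtain ⟨a, ha⟩ := (QuotientAddGroup.eq_iff_sub_mem.mp h.symm)
      exact ⟨a, by simp only [zsmul_eq_mul, mul_one] at ha; linarith⟩
    choose a ha using hex
    have hy : y = x + fun i => (a i : ℝ) := funext fun i => (ha i).symm
    subst hy
    refine ((Equiv.addLeft a).tsum_eq fun m => g (x + fun i => (m i : ℝ))).symm.trans
      (tsum_congr fun m => ?_)
    congr 1
    ext i
    simp [add_assoc]
  let F : C(UnitAddTorus ι, ℂ) := hq.isQuotientMap.lift (f := q) P hP
  have hF (x : ι → ℝ) : F (fun i => x i) = ∑' m : ι → ℤ, g (x + fun i => (m i : ℝ)) :=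
    DFunLike.congr_fun (hq.isQuotientMap.lift_comp (f := q) P hP) x
  have hcoeff := g.mFourierCoeff_eq_integral_of_forall_eq_tsum hF
  have hs := hasSum_mFourier_series_apply_of_summable (f := F)
    (hg.congr fun k => (hcoeff k).symm) (fun i => ((0 : ι → ℝ) i : UnitAddCircle))
  rw [hF] at hs
  simp only [zero_add] at hs
  rw [← hs.tsum_eq]
  refine tsum_congr fun k => ?_
  rw [hcoeff]
  simp [mFourier]

end Poisson

section Lattice

variable {ι : Type*} [Fintype ι] [DecidableEq ι]

/-- The map `x ↦ M x` from coordinate vectors to Euclidean space, for an invertible matrix `M`. -/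
noncomputable def Matrix.toEuclideanCLE (M : Matrix ι ι ℝ) (hM : IsUnit M.det) :
    (ι → ℝ) ≃L[ℝ] EuclideanSpace ℝ ι :=
  (M.toLinearEquiv' (M.invertibleOfIsUnitDet hM)).toContinuousLinearEquiv.trans
    (EuclideanSpace.equiv ι ℝ).symm

theorem Matrix.toEuclideanCLE_apply (M : Matrix ι ι ℝ) (hM : IsUnit M.det) (x : ι → ℝ) :
    M.toEuclideanCLE hM x = WithLp.toLp 2 (M.mulVec x) := rfl

theorem Matrix.measurePreserving_toEuclideanCLE (M : Matrix ι ι ℝ) (hM : IsUnit M.det)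
    (hdet : |M.det| = 1) : MeasurePreserving (M.toEuclideanCLE hM) := by
  have hmap : MeasurePreserving (Matrix.toLin' M) := by
    refine ⟨(LinearMap.continuous_of_finiteDimensional _).measurable, ?_⟩
    rw [Real.map_matrix_volume_pi_eq_smul_volume_pi hM.ne_zero, abs_inv, hdet]
    simp
  exact (PiLp.volume_preserving_toLp ι).comp hmap

theorem Matrix.inner_toEuclideanCLE (B : Matrix ι ι ℝ) (hB : IsUnit Bᵀ.det)
    (hB' : IsUnit B⁻¹.det) (x y : ι → ℝ) :
    inner ℝ (Bᵀ.toEuclideanCLE hB x) (B⁻¹.toEuclideanCLE hB' y) = x ⬝ᵥ y := by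
  have hunit : IsUnit B.det := by rwa [Matrix.det_transpose] at hB
  rw [toEuclideanCLE_apply, toEuclideanCLE_apply, EuclideanSpace.inner_toLp_toLp, star_trivial,
    Matrix.mulVec_transpose, dotProduct_comm, ← Matrix.dotProduct_mulVec, Matrix.mulVec_mulVec,
    Matrix.mul_nonsing_inv _ hunit, Matrix.one_mulVec]

open UnitAddTorus in
theorem SchwartzMap.integral_mFourier_comp_toEuclideanCLE (f : 𝓢(EuclideanSpace ℝ ι, ℂ))
    (B : Matrix ι ι ℝ) (hB : IsUnit Bᵀ.det) (hB' : IsUnit B⁻¹.det) (hdet : |B.det| = 1)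
    (k : ι → ℤ) :
    ∫ x : ι → ℝ, mFourier (-k) (fun i => x i) * f (Bᵀ.toEuclideanCLE hB x) =
      𝓕 (f : EuclideanSpace ℝ ι → ℂ) (B⁻¹.toEuclideanCLE hB' fun i => (k i : ℝ)) := by
  rw [Real.fourier_eq', ← (Bᵀ.measurePreserving_toEuclideanCLE hB
    (by rwa [Matrix.det_transpose])).integral_comp
    (Bᵀ.toEuclideanCLE hB).toHomeomorph.measurableEmbedding]
  congr 1 with x
  rw [B.inner_toEuclideanCLE, smul_eq_mul]
  congr 1
  simp only [mFourier, ContinuousMap.coe_mk, fourier_coe_apply, ← Complex.exp_sum, dotProduct]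
  congr 1
  push_cast
  rw [Finset.mul_sum, Finset.sum_mul]
  refine Finset.sum_congr rfl fun i _ => ?_
  simp only [Pi.neg_apply]
  push_cast
  ring

/-- Poisson summation for the lattice spanned by the rows of `B`, with dual lattice spanned by
the columns of `B⁻¹`. -/
theorem SchwartzMap.exists_hasSum_lattice_and_hasSum_fourier_dual
    (f : 𝓢(EuclideanSpace ℝ ι, ℂ)) (B : Matrix ι ι ℝ) (hB : IsUnit Bᵀ.det)
    (hB' : IsUnit B⁻¹.det) (hdet : |B.det| = 1) :
    ∃ s, HasSum (fun m : ι → ℤ => f (Bᵀ.toEuclideanCLE hB fun i => (m i : ℝ))) s ∧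
      HasSum (fun k : ι → ℤ => 𝓕 (f : EuclideanSpace ℝ ι → ℂ)
        (B⁻¹.toEuclideanCLE hB' fun i => (k i : ℝ))) s := by
  let g : 𝓢(ι → ℝ, ℂ) := compCLMOfContinuousLinearEquiv ℝ (Bᵀ.toEuclideanCLE hB) f
  let h : 𝓢(ι → ℝ, ℂ) := compCLMOfContinuousLinearEquiv ℝ (B⁻¹.toEuclideanCLE hB') (𝓕 f)
  have hg : Summable fun m : ι → ℤ => g fun i => (m i : ℝ) := by
    simpa only [zero_add] using g.summable_add_intCast 0
  have hh : Summable fun m : ι → ℤ => h fun i => (m i : ℝ) := by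
    simpa only [zero_add] using h.summable_add_intCast 0
  have hcoeff (k : ι → ℤ) := f.integral_mFourier_comp_toEuclideanCLE B hB hB' hdet k
  have hpoisson := g.tsum_intCast_eq_tsum_integral (hh.congr fun k => (hcoeff k).symm)
  exact ⟨_, hg.hasSum, (hpoisson.trans (tsum_congr hcoeff)) ▸ hh.hasSum⟩

end Lattice

theorem mem_latticeOf_iff {n : ℕ} {B : Matrix (Fin n) (Fin n) ℝ} (hB : IsUnit B.transpose.det)
    {v : EuclideanSpace ℝ (Fin n)} :
    v ∈ latticeOf B ↔
      ∃ c : Fin n → ℤ, B.transpose.toEuclideanCLE hB (fun i => (c i : ℝ)) = v := by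
  refine exists_congr fun c => ?_
  rw [Matrix.toEuclideanCLE_apply, Matrix.mulVec_transpose, eq_comm]
  constructor
  · intro h
    ext j
    exact congrFun h j
  · rintro rfl
    rfl

theorem mem_dualLattice_latticeOf_iff {n : ℕ} {B : Matrix (Fin n) (Fin n) ℝ}
    (hB : IsUnit B.transpose.det) (hB' : IsUnit B⁻¹.det) {v : EuclideanSpace ℝ (Fin n)} :
    v ∈ dualLattice (latticeOf B) ↔
      ∃ k : Fin n → ℤ, B⁻¹.toEuclideanCLE hB' (fun i => (k i : ℝ)) = v := by
  constructor
  · intro hv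
    obtain ⟨y, rfl⟩ := (B⁻¹.toEuclideanCLE hB').surjective v
    have hy (i : Fin n) : ∃ m : ℤ, y i = m := by
      obtain ⟨m, hm⟩ := hv _ ((mem_latticeOf_iff hB).mpr ⟨Pi.single i 1, rfl⟩)
      refine ⟨m, ?_⟩
      rw [← hm, B.inner_toEuclideanCLE]
      simp [dotProduct, Pi.single_apply]
    choose k hk using hy
    exact ⟨k, by rw [funext hk]⟩
  · rintro ⟨k, rfl⟩ w hw
    obtain ⟨c, rfl⟩ := (mem_latticeOf_iff hB).mp hw
    exact ⟨∑ i, c i * k i, by rw [B.inner_toEuclideanCLE]; simp [dotProduct]⟩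

/-- Equality analysis for the Cohn–Elkies LP bound: if `f` is a magic function
matching the density of a unimodular lattice `L` whose nonzero vectors have
length at least `r₁`, then `f` and `f̂` vanish on `L \ {0}`. -/
theorem cohn_elkies_equality {n : ℕ} (f : SchwartzMap (EuclideanSpace ℝ (Fin n)) ℝ)
    (r₁ : ℝ) (hr₁ : 0 < r₁)
    (hf00 : f 0 = 1)
    (hf0 : 𝓕 (fun x => (f x : ℂ)) 0 = 1)
    (hfpos : ∀ u, 0 ≤ (𝓕 (fun x => (f x : ℂ)) u).re ∧ (𝓕 (fun x => (f x : ℂ)) u).im = 0)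
    (hfneg : ∀ x : EuclideanSpace ℝ (Fin n), r₁ ≤ ‖x‖ → f x ≤ 0)
    (B : Matrix (Fin n) (Fin n) ℝ) (hdet : |B.det| = 1)
    (hunimod : dualLattice (latticeOf B) = latticeOf B)
    (hmin : ∀ v ∈ latticeOf B, v ≠ 0 → r₁ ≤ ‖v‖) :
    ∀ v ∈ latticeOf B, v ≠ 0 → f v = 0 ∧ 𝓕 (fun x => (f x : ℂ)) v = 0 := by
  have hunit : IsUnit B.det := isUnit_iff_ne_zero.mpr fun h => by simp [h] at hdet
  have hB : IsUnit B.transpose.det := by rwa [Matrix.det_transpose]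
  have hB' : IsUnit B⁻¹.det := Matrix.isUnit_nonsing_inv_det B hunit
  set A := B.transpose.toEuclideanCLE hB
  set A' := B⁻¹.toEuclideanCLE hB'
  let fc : 𝓢(EuclideanSpace ℝ (Fin n), ℂ) := SchwartzMap.postcompCLM Complex.ofRealCLM f
  set φ := 𝓕 (fun x => (f x : ℂ))
  obtain ⟨s, hs, hs'⟩ := fc.exists_hasSum_lattice_and_hasSum_fourier_dual B hB hB' hdet
  have hdiff : HasSum (fun m : Fin n → ℤ =>
      (φ (A' fun i => (m i : ℝ))).re - f (A fun i => (m i : ℝ))) 0 := by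
    simpa only [sub_self, map_zero, map_sub] using! Complex.reCLM.hasSum (hs'.sub hs)
  have hcast (m : Fin n → ℤ) (hm : m ≠ 0) : (fun i => (m i : ℝ)) ≠ 0 := fun h =>
    hm (funext fun i => by simpa using congrFun h i)
  have hneg (m : Fin n → ℤ) (hm : m ≠ 0) : f (A fun i => (m i : ℝ)) ≤ 0 :=
    hfneg _ (hmin _ ((mem_latticeOf_iff hB).mpr ⟨m, rfl⟩)
      ((map_ne_zero_iff _ A.injective).mpr (hcast m hm)))
  have hnonneg (m : Fin n → ℤ) :
      0 ≤ (φ (A' fun i => (m i : ℝ))).re - f (A fun i => (m i : ℝ)) := by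
    rcases eq_or_ne m 0 with rfl | hm
    · have h0 : (fun i => (((0 : Fin n → ℤ) i : ℤ) : ℝ)) = 0 := by ext; simp
      rw [h0, map_zero, map_zero, hf0, hf00, Complex.one_re, sub_self]
    · linarith [(hfpos (A' fun i => (m i : ℝ))).1, hneg m hm]
  have hzero (m : Fin n → ℤ) :=
    congrFun ((hasSum_zero_iff_of_nonneg hnonneg).mp hdiff) m
  have hvanish (m : Fin n → ℤ) (hm : m ≠ 0) :
      f (A fun i => (m i : ℝ)) = 0 ∧ (φ (A' fun i => (m i : ℝ))).re = 0 := by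
    have h : _ - _ = (0 : ℝ) := hzero m
    have h1 := (hfpos (A' fun i => (m i : ℝ))).1
    have h2 := hneg m hm
    constructor <;> linarith
  intro v hv hv0
  constructor
  · obtain ⟨c, rfl⟩ := (mem_latticeOf_iff hB).mp hv
    exact (hvanish c (by rintro rfl; exact hv0 (by simp [← Pi.zero_def]))).1
  · obtain ⟨k, rfl⟩ := (mem_dualLattice_latticeOf_iff hB hB').mp (hunimod ▸ hv)
    exact Complex.ext (hvanish k (by rintro rfl; exact hv0 (by simp [← Pi.zero_def]))).2
      (hfpos _).2
end
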